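/- For every ε > 0 there exists a constant C > 0 such that the following holds for all sufficiently large natural numbers N: for all subsets 𝔄, 𝔅 ⊆ {N+1, …, 2N} with |𝔄||𝔅| ≥ N^{4/3+ε} and every real Δ with 0 < Δ ≤ 1/2, one has |H(𝔄,𝔅;Δ) − 2Δ|𝔄||𝔅|| ≤ C · N · (|𝔄||𝔅|)^{1/4} · (log N)^{3/2}. -/

import Mathlib

open scoped Classical

/-- Distance from a real number to the nearest integer. -/
noncomputable def distNearestInt (t : ℝ) : ℝ := |t - round t|

/-- `H(𝔄,𝔅;Δ)` : the number of pairs `(a,b) ∈ 𝔄 × 𝔅` with `‖√(ab)‖ < Δ`. -/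
noncomputable def Hcount (A B : Finset ℕ) (Δ : ℝ) : ℕ :=
  ((A ×ˢ B).filter (fun p => distNearestInt (Real.sqrt (p.1 * p.2)) < Δ)).card

section Trapezoid

/-- The `1`-periodic trapezoid equal to `1` on `[-u, u]`, to `0` outside `[-u - w, u + w]`, and
linear in between. -/
noncomputable def trapezoid (u w x : ℝ) : ℝ :=
  (|x - round x + (u + w)| + |x - round x - (u + w)| - |x - round x + u| - |x - round x - u|)
    / (2 * w)

/-- The cosine Fourier coefficients of `trapezoid u w`. -/
noncomputable def trapezoidCoeff (u w : ℝ) (n : ℕ) : ℝ :=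
  (Real.cos (2 * Real.pi * n * u) - Real.cos (2 * Real.pi * n * (u + w))) /
    (Real.pi ^ 2 * w * (n : ℝ) ^ 2)

lemma hasSum_cos_div_sq {y : ℝ} (hy : |y| ≤ 1) :
    HasSum (fun n : ℕ => Real.cos (2 * Real.pi * n * y) / (n : ℝ) ^ 2)
      (Real.pi ^ 2 * (y ^ 2 - |y| + 1 / 6)) := by
  have h := hasSum_one_div_nat_pow_mul_cos (k := 1) one_ne_zero (x := |y|) ⟨abs_nonneg y, hy⟩
  convert! h using 1
  · ext n
    have : Real.cos (2 * Real.pi * n * |y|) = Real.cos (2 * Real.pi * n * y) := by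
      rcases abs_choice y with h | h <;> rw [h]
      rw [mul_neg, Real.cos_neg]
    rw [this]
    ring
  · simp [Polynomial.bernoulli_def, Finset.sum_range_succ, bernoulli, bernoulli'_two,
      Nat.factorial]
    rw [← sq_abs y]
    ring

lemma hasSum_trapezoid {u w : ℝ} (hu : 0 ≤ u) (hw : 0 < w) (huw : u + w ≤ 1 / 2) (x : ℝ) :
    HasSum (fun n : ℕ => trapezoidCoeff u w n * Real.cos (2 * Real.pi * n * x))
      (trapezoid u w x - (2 * u + w)) := by
  have hr := abs_sub_round x
  have hcos : ∀ n : ℕ, Real.cos (2 * Real.pi * n * x) =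
      Real.cos (2 * Real.pi * n * (x - round x)) := by
    intro n
    have := Real.cos_add_int_mul_two_pi (2 * Real.pi * n * (x - round x)) (n * round x)
    rw [← this]
    congr 1
    push_cast
    ring
  unfold trapezoid
  simp_rw [hcos]
  generalize x - round x = r at *
  rw [abs_le] at hr
  have h1 := hasSum_cos_div_sq (y := r + (u + w)) (by rw [abs_le]; constructor <;> linarith)
  have h2 := hasSum_cos_div_sq (y := r - (u + w)) (by rw [abs_le]; constructor <;> linarith)
  have h3 := hasSum_cos_div_sq (y := r + u) (by rw [abs_le]; constructor <;> linarith)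
  have h4 := hasSum_cos_div_sq (y := r - u) (by rw [abs_le]; constructor <;> linarith)
  have h := (((h1.add h2).sub h3).sub h4).mul_left (-(1 / (2 * w * Real.pi ^ 2)))
  have hpi := Real.pi_ne_zero
  convert! h using 1
  · ext n
    have e1 : 2 * Real.pi * n * (r + (u + w)) =
      2 * Real.pi * n * r + 2 * Real.pi * n * (u + w) := by ring
    have e2 : 2 * Real.pi * n * (r - (u + w)) =
      2 * Real.pi * n * r - 2 * Real.pi * n * (u + w) := by ring
    have e3 : 2 * Real.pi * n * (r + u) =
      2 * Real.pi * n * r + 2 * Real.pi * n * u := by ring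
    have e4 : 2 * Real.pi * n * (r - u) =
      2 * Real.pi * n * r - 2 * Real.pi * n * u := by ring
    rw [e1, e2, e3, e4, Real.cos_add, Real.cos_sub, Real.cos_add, Real.cos_sub]
    unfold trapezoidCoeff
    rcases eq_or_ne (n : ℝ) 0 with hn | hn
    · simp [hn]
    · field_simp
      ring
  · field_simp
    ring

lemma abs_trapezoidCoeff_le_div_sq (u : ℝ) {w : ℝ} (hw : 0 < w) (n : ℕ) :
    |trapezoidCoeff u w n| ≤ 1 / (w * (n : ℝ) ^ 2) := by
  rcases eq_or_ne n 0 with rfl | hn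
  · simp [trapezoidCoeff]
  have hn : (0 : ℝ) < n := by positivity
  unfold trapezoidCoeff
  rw [abs_div, abs_of_pos (by positivity : 0 < Real.pi ^ 2 * w * (n : ℝ) ^ 2),
    div_le_div_iff₀ (by positivity) (by positivity)]
  have h1 : |Real.cos (2 * Real.pi * n * u) - Real.cos (2 * Real.pi * n * (u + w))| ≤ 2 := by
    have a1 := Real.cos_le_one (2 * Real.pi * n * u)
    have a2 := Real.cos_le_one (2 * Real.pi * n * (u + w))
    have a3 := Real.neg_one_le_cos (2 * Real.pi * n * u)
    have a4 := Real.neg_one_le_cos (2 * Real.pi * n * (u + w))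
    rw [abs_le]
    constructor <;> linarith
  have hpi : 2 ≤ Real.pi ^ 2 := by nlinarith [Real.pi_gt_three]
  have hp : 0 ≤ w * (n : ℝ) ^ 2 := by positivity
  nlinarith [mul_le_mul_of_nonneg_right (h1.trans hpi) hp]

lemma abs_trapezoidCoeff_le_div (u : ℝ) {w : ℝ} (hw : 0 < w) (n : ℕ) :
    |trapezoidCoeff u w n| ≤ 1 / (n : ℝ) := by
  rcases eq_or_ne n 0 with rfl | hn
  · simp [trapezoidCoeff]
  have hn : (0 : ℝ) < n := by positivity
  unfold trapezoidCoeff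
  rw [abs_div, abs_of_pos (by positivity : 0 < Real.pi ^ 2 * w * (n : ℝ) ^ 2),
    div_le_div_iff₀ (by positivity) (by positivity)]
  have h1 : |Real.cos (2 * Real.pi * n * u) - Real.cos (2 * Real.pi * n * (u + w))| ≤
      2 * Real.pi * n * w := by
    refine (Real.abs_cos_sub_cos_le _ _).trans ?_
    rw [abs_le]
    have : 0 < 2 * Real.pi * n * w := by positivity
    constructor <;> nlinarith
  have hpi : 2 * Real.pi ≤ Real.pi ^ 2 := by nlinarith [Real.pi_gt_three]
  have hp : 0 ≤ w * (n : ℝ) ^ 2 := by positivity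
  nlinarith [mul_le_mul_of_nonneg_right h1 hn.le, mul_le_mul_of_nonneg_right hpi hp]

lemma trapezoid_nonneg {u w : ℝ} (hu : 0 ≤ u) (hw : 0 < w) (x : ℝ) : 0 ≤ trapezoid u w x := by
  unfold trapezoid
  generalize x - round x = r
  apply div_nonneg _ (by positivity)
  rcases abs_cases (r + (u + w)) with h1 | h1 <;> rcases abs_cases (r - (u + w)) with h2 | h2 <;>
  rcases abs_cases (r + u) with h3 | h3 <;> rcases abs_cases (r - u) with h4 | h4 <;> linarith

lemma trapezoid_le_one {u w : ℝ} (hu : 0 ≤ u) (hw : 0 < w) (x : ℝ) : trapezoid u w x ≤ 1 := by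
  unfold trapezoid
  generalize x - round x = r
  rw [div_le_one (by positivity)]
  rcases abs_cases (r + (u + w)) with h1 | h1 <;> rcases abs_cases (r - (u + w)) with h2 | h2 <;>
  rcases abs_cases (r + u) with h3 | h3 <;> rcases abs_cases (r - u) with h4 | h4 <;> linarith

lemma trapezoid_eq_one {u w x : ℝ} (hw : 0 < w) (hx : distNearestInt x ≤ u) :
    trapezoid u w x = 1 := by
  unfold distNearestInt at hx
  unfold trapezoid
  generalize x - round x = r at *
  rw [abs_le] at hx
  rw [abs_of_nonneg (by linarith : 0 ≤ r + (u + w)), abs_of_nonpos (by linarith : r - (u + w) ≤ 0),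
    abs_of_nonneg (by linarith : 0 ≤ r + u), abs_of_nonpos (by linarith : r - u ≤ 0)]
  field_simp
  ring

lemma trapezoid_eq_zero {u w x : ℝ} (hu : 0 ≤ u) (hw : 0 < w) (hx : u + w ≤ distNearestInt x) :
    trapezoid u w x = 0 := by
  unfold distNearestInt at hx
  unfold trapezoid
  generalize x - round x = r at *
  rw [div_eq_zero_iff]
  left
  rcases abs_cases r with ⟨h, h'⟩ | ⟨h, h'⟩ <;> rw [h] at hx
  · rw [abs_of_nonneg (by linarith : 0 ≤ r + (u + w)),
      abs_of_nonneg (by linarith : 0 ≤ r - (u + w)),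
      abs_of_nonneg (by linarith : 0 ≤ r + u), abs_of_nonneg (by linarith : 0 ≤ r - u)]
    ring
  · rw [abs_of_nonpos (by linarith : r + (u + w) ≤ 0),
      abs_of_nonpos (by linarith : r - (u + w) ≤ 0),
      abs_of_nonpos (by linarith : r + u ≤ 0), abs_of_nonpos (by linarith : r - u ≤ 0)]
    ring

end Trapezoid

section MeanSquare

lemma sq_le_integral_of_hasDerivAt {F F' : ℝ → ℝ} (hF : ∀ y, HasDerivAt F (F' y) y)
    (hF' : Continuous F') {α β X : ℝ} (hαβ : α < β) (hX : 0 < X) :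
    F α ^ 2 ≤ (β - α)⁻¹ * (∫ y in α..β, F y ^ 2) +
      (X * (∫ y in α..β, F y ^ 2) + X⁻¹ * ∫ y in α..β, F' y ^ 2) := by
  have hFc : Continuous F := continuous_iff_continuousAt.2 fun y => (hF y).continuousAt
  have hsq : ∀ a b, IntervalIntegrable (fun y => F y ^ 2) MeasureTheory.volume a b :=
    fun a b => (hFc.pow 2).intervalIntegrable a b
  have hsq' : ∀ a b, IntervalIntegrable (fun y => F' y ^ 2) MeasureTheory.volume a b :=
    fun a b => (hF'.pow 2).intervalIntegrable a b
  set K : ℝ := X * (∫ y in α..β, F y ^ 2) + X⁻¹ * ∫ y in α..β, F' y ^ 2 with hK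
  have hKint : K = ∫ y in α..β, (X * F y ^ 2 + X⁻¹ * F' y ^ 2) := by
    rw [intervalIntegral.integral_add ((hsq _ _).const_mul _) ((hsq' _ _).const_mul _),
      intervalIntegral.integral_const_mul, intervalIntegral.integral_const_mul]
  have hcont : Continuous fun y => X * F y ^ 2 + X⁻¹ * F' y ^ 2 := by fun_prop
  have key : ∀ t ∈ Set.Icc α β, F α ^ 2 ≤ F t ^ 2 + K := by
    intro t ht
    have h1 : ∫ y in α..t, (2 * F y * F' y) = F t ^ 2 - F α ^ 2 := by
      apply intervalIntegral.integral_eq_sub_of_hasDerivAt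
        (f := fun y => F y ^ 2) (f' := fun y => 2 * F y * F' y)
      · intro y _
        simpa using (hF y).fun_pow 2
      · exact (by fun_prop : Continuous fun y => 2 * F y * F' y).intervalIntegrable _ _
    have h2 : ∫ y in α..t, -(2 * F y * F' y) ≤ ∫ y in α..t, (X * F y ^ 2 + X⁻¹ * F' y ^ 2) := by
      apply intervalIntegral.integral_mono_on ht.1
      · exact (by fun_prop : Continuous fun y => -(2 * F y * F' y)).intervalIntegrable _ _
      · exact hcont.intervalIntegrable _ _
      · intro y _
        have : X * F y ^ 2 + X⁻¹ * F' y ^ 2 + 2 * F y * F' y = X⁻¹ * (X * F y + F' y) ^ 2 := by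
          field_simp
          ring
        have h0 : 0 ≤ X⁻¹ * (X * F y + F' y) ^ 2 := by positivity
        linarith
    have h3 : ∫ y in α..t, (X * F y ^ 2 + X⁻¹ * F' y ^ 2) ≤ K := by
      rw [hKint]
      apply intervalIntegral.integral_mono_interval le_rfl ht.1 ht.2
      · exact Filter.Eventually.of_forall fun y => by
          simp only [Pi.zero_apply]
          positivity
      · exact hcont.intervalIntegrable _ _
    rw [intervalIntegral.integral_neg, h1] at h2
    linarith
  have hint : ∫ _ in α..β, F α ^ 2 ≤ ∫ t in α..β, (F t ^ 2 + K) := by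
    apply intervalIntegral.integral_mono_on hαβ.le
    · simp
    · exact (hsq _ _).add (by simp)
    · exact key
  rw [intervalIntegral.integral_add (hsq _ _) (by simp)] at hint
  simp only [intervalIntegral.integral_const, smul_eq_mul] at hint
  have hpos : 0 < β - α := sub_pos.2 hαβ
  have h4 := mul_le_mul_of_nonneg_left hint (inv_pos.2 hpos).le
  rw [mul_add, ← mul_assoc, ← mul_assoc, inv_mul_cancel₀ hpos.ne', one_mul, one_mul] at h4
  exact h4

/-- Gallagher's inequality: the mean square of `F` over well-spaced points, bounded by the
continuous mean squares of `F` and its derivative. -/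
lemma sum_sq_le_integral_of_hasDerivAt {F F' : ℝ → ℝ} (hF : ∀ y, HasDerivAt F (F' y) y)
    (hF' : Continuous F') {y : ℕ → ℝ} {n : ℕ} {l X : ℝ} (hl : 0 < l) (hX : 0 < X)
    (hy : ∀ k < n, l ≤ y (k + 1) - y k) :
    ∑ k ∈ Finset.range n, F (y k) ^ 2 ≤
      (l⁻¹ + X) * (∫ t in (y 0)..(y n), F t ^ 2) + X⁻¹ * ∫ t in (y 0)..(y n), F' t ^ 2 := by
  have hFc : Continuous F := continuous_iff_continuousAt.2 fun y => (hF y).continuousAt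
  rw [← intervalIntegral.sum_integral_adjacent_intervals
      (f := fun t => F t ^ 2) (fun k _ => (hFc.pow 2).intervalIntegrable _ _),
    ← intervalIntegral.sum_integral_adjacent_intervals
      (f := fun t => F' t ^ 2) (fun k _ => (hF'.pow 2).intervalIntegrable _ _),
    Finset.mul_sum, Finset.mul_sum, ← Finset.sum_add_distrib]
  apply Finset.sum_le_sum
  intro k hk
  have hk' := hy k (Finset.mem_range.1 hk)
  have h := sq_le_integral_of_hasDerivAt hF hF' (by linarith : y k < y (k + 1)) hX
  have h0 : 0 ≤ ∫ t in (y k)..(y (k + 1)), F t ^ 2 :=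
    intervalIntegral.integral_nonneg (by linarith) fun _ _ => sq_nonneg _
  have hinv : (y (k + 1) - y k)⁻¹ ≤ l⁻¹ := inv_anti₀ hl hk'
  nlinarith [mul_le_mul_of_nonneg_right hinv h0]

lemma abs_integral_cos_mul_le {κ α β : ℝ} (hκ : κ ≠ 0) :
    |∫ y in α..β, Real.cos (κ * y)| ≤ 2 / |κ| := by
  rw [intervalIntegral.integral_comp_mul_left (fun y => Real.cos y) hκ, integral_cos, smul_eq_mul,
    abs_mul, abs_inv, div_eq_inv_mul]
  apply mul_le_mul_of_nonneg_left _ (by positivity)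
  have a1 := Real.sin_le_one (κ * β)
  have a2 := Real.sin_le_one (κ * α)
  have a3 := Real.neg_one_le_sin (κ * β)
  have a4 := Real.neg_one_le_sin (κ * α)
  rw [abs_le]
  constructor <;> linarith

lemma abs_half_integral_cos_add_cos_le {κ κ' s α β : ℝ} (hκ : 0 ≤ κ) (hκ' : 0 ≤ κ')
    (hne : κ ≠ κ') (hs : |s| = 1) :
    |∫ y in α..β, (Real.cos ((κ - κ') * y) + s * Real.cos ((κ + κ') * y)) / 2| ≤
      2 / |κ - κ'| := by
  have hne' : κ - κ' ≠ 0 := sub_ne_zero.2 hne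
  have hpos : 0 < κ + κ' := by
    rcases hκ.lt_or_eq with h | h
    · linarith
    · rcases hκ'.lt_or_eq with h' | h'
      · linarith
      · exact absurd (h.symm.trans h') hne
  have hle : |κ - κ'| ≤ |κ + κ'| := by
    rw [abs_of_pos hpos, abs_le]
    constructor <;> linarith
  rw [intervalIntegral.integral_div, intervalIntegral.integral_add
    ((by fun_prop : Continuous fun y => Real.cos ((κ - κ') * y)).intervalIntegrable _ _)
    ((by fun_prop : Continuous fun y => s * Real.cos ((κ + κ') * y)).intervalIntegrable _ _),
    intervalIntegral.integral_const_mul, abs_div, abs_two]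
  have h1 := abs_integral_cos_mul_le (α := α) (β := β) hne'
  have h2 := abs_integral_cos_mul_le (α := α) (β := β) hpos.ne'
  have h3 : 2 / |κ + κ'| ≤ 2 / |κ - κ'| :=
    div_le_div_of_nonneg_left (by norm_num) (abs_pos.2 hne') hle
  have h4 := abs_add_le (∫ y in α..β, Real.cos ((κ - κ') * y))
    (s * ∫ y in α..β, Real.cos ((κ + κ') * y))
  rw [abs_mul, hs, one_mul] at h4
  linarith

lemma abs_integral_cos_mul_cos_le {κ κ' α β : ℝ} (hκ : 0 ≤ κ) (hκ' : 0 ≤ κ') (hne : κ ≠ κ') :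
    |∫ y in α..β, Real.cos (κ * y) * Real.cos (κ' * y)| ≤ 2 / |κ - κ'| := by
  convert! abs_half_integral_cos_add_cos_le (s := 1) (α := α) (β := β) hκ hκ' hne (by simp)
    using 4 with y
  rw [sub_mul, add_mul, Real.cos_sub, Real.cos_add]
  ring

lemma abs_integral_sin_mul_sin_le {κ κ' α β : ℝ} (hκ : 0 ≤ κ) (hκ' : 0 ≤ κ') (hne : κ ≠ κ') :
    |∫ y in α..β, Real.sin (κ * y) * Real.sin (κ' * y)| ≤ 2 / |κ - κ'| := by
  convert! abs_half_integral_cos_add_cos_le (s := -1) (α := α) (β := β) hκ hκ' hne (by simp)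
    using 4 with y
  rw [sub_mul, add_mul, Real.cos_sub, Real.cos_add]
  ring

lemma abs_integral_mul_le_sub {f g : ℝ → ℝ} (hf : ∀ y, |f y| ≤ 1) (hg : ∀ y, |g y| ≤ 1)
    {α β : ℝ} (hαβ : α ≤ β) : |∫ y in α..β, f y * g y| ≤ β - α := by
  have h := intervalIntegral.norm_integral_le_of_norm_le_const (a := α) (b := β)
    (f := fun y => f y * g y) (C := 1) fun y _ => by
      rw [Real.norm_eq_abs, abs_mul]
      exact mul_le_one₀ (hf y) (abs_nonneg _) (hg y)
  rwa [one_mul, abs_of_nonneg (sub_nonneg.2 hαβ), Real.norm_eq_abs] at h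

lemma integral_sum_sq_le {ι : Type*} (s : Finset ι) (c : ι → ℝ) (f : ι → ℝ → ℝ)
    (hf : ∀ i, Continuous (f i)) {M : ℝ} (hc : ∀ i ∈ s, |c i| ≤ M) {α β : ℝ}
    (K : ι → ι → ℝ) (hK : ∀ i ∈ s, ∀ j ∈ s, |∫ y in α..β, f i y * f j y| ≤ K i j) :
    ∫ y in α..β, (∑ i ∈ s, c i * f i y) ^ 2 ≤ M ^ 2 * ∑ i ∈ s, ∑ j ∈ s, K i j := by
  have h : ∀ y, (∑ i ∈ s, c i * f i y) ^ 2 =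
      ∑ i ∈ s, ∑ j ∈ s, (c i * c j) * (f i y * f j y) := by
    intro y
    rw [sq, Finset.sum_mul_sum]
    exact Finset.sum_congr rfl fun i _ => Finset.sum_congr rfl fun j _ => by ring
  simp_rw [h]
  rw [intervalIntegral.integral_finsetSum fun i _ =>
    (by fun_prop : Continuous fun y =>
      ∑ j ∈ s, (c i * c j) * (f i y * f j y)).intervalIntegrable _ _, Finset.mul_sum]
  apply Finset.sum_le_sum
  intro i hi
  rw [intervalIntegral.integral_finsetSum fun j _ =>
    (by fun_prop : Continuous fun y =>
      (c i * c j) * (f i y * f j y)).intervalIntegrable _ _, Finset.mul_sum]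
  apply Finset.sum_le_sum
  intro j hj
  rw [intervalIntegral.integral_const_mul]
  have h1 : |c i| * |c j| ≤ M ^ 2 := by
    rw [sq]
    exact mul_le_mul (hc i hi) (hc j hj) (abs_nonneg _) ((abs_nonneg _).trans (hc i hi))
  calc _ ≤ |(c i * c j) * ∫ y in α..β, f i y * f j y| := le_abs_self _
    _ = |c i| * |c j| * |∫ y in α..β, f i y * f j y| := by rw [abs_mul, abs_mul]
    _ ≤ M ^ 2 * K i j := mul_le_mul h1 (hK i hi j hj) (abs_nonneg _) (sq_nonneg _)

end MeanSquare

section PairCount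

lemma card_le_of_pairwise_modEq {N r : ℕ} (hr : 0 < r) {S : Finset ℕ}
    (hS : S ⊆ Finset.Ioc N (2 * N)) (hmod : ∀ a ∈ S, ∀ b ∈ S, a ≡ b [MOD r]) :
    (S.card : ℝ) ≤ N / r + 1 := by
  rcases S.eq_empty_or_nonempty with rfl | ⟨v, hv⟩
  · simp
    positivity
  have hsub : S ⊆ (Finset.Ioc N (2 * N)).filter fun x => x ≡ v [MOD r] := fun a ha =>
    Finset.mem_filter.2 ⟨hS ha, hmod a ha v hv⟩
  have hcard := Nat.Ioc_filter_modEq_card N (2 * N) hr v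
  have hle : ((S.card : ℕ) : ℤ) ≤
      max (⌊(((2 * N : ℕ) : ℚ) - v) / r⌋ - ⌊((N : ℚ) - v) / r⌋) 0 := by
    rw [← hcard]
    exact_mod_cast Finset.card_le_card hsub
  have hq : ((S.card : ℕ) : ℚ) ≤ N / r + 1 := by
    have h0 : (0 : ℚ) ≤ N / r + 1 := by positivity
    rcases le_max_iff.1 hle with h | h
    · have h1 := Int.floor_le ((((2 * N : ℕ) : ℚ) - v) / r)
      have h2 := Int.lt_floor_add_one (((N : ℚ) - v) / r)
      have h3 : ((S.card : ℕ) : ℚ) ≤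
          ⌊(((2 * N : ℕ) : ℚ) - v) / r⌋ - ⌊((N : ℚ) - v) / r⌋ := by exact_mod_cast h
      have h4 : (((2 * N : ℕ) : ℚ) - v) / r - ((N : ℚ) - v) / r = N / r := by
        push_cast
        ring
      linarith
    · have : ((S.card : ℕ) : ℚ) ≤ 0 := by exact_mod_cast h
      linarith
  have hreal := (Rat.cast_le (K := ℝ)).2 hq
  push_cast at hreal
  exact hreal

lemma card_filter_sub_eq_le (N : ℕ) {u v : ℕ} (hv : 0 < v) (huv : Nat.Coprime u v) (k : ℤ) :
    ((((Finset.Ioc N (2 * N)) ×ˢ (Finset.Ioc N (2 * N))).filter fun p =>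
      (u : ℤ) ^ 2 * p.1 - (v : ℤ) ^ 2 * p.2 = k).card : ℝ) ≤ N / (v : ℝ) ^ 2 + 1 := by
  set P := ((Finset.Ioc N (2 * N)) ×ˢ (Finset.Ioc N (2 * N))).filter fun p =>
      (u : ℤ) ^ 2 * p.1 - (v : ℤ) ^ 2 * p.2 = k with hP
  have hinj : Set.InjOn Prod.fst (P : Set (ℕ × ℕ)) := by
    intro p hp q hq hpq
    have hp' := (Finset.mem_filter.1 (Finset.mem_coe.1 hp)).2
    have hq' := (Finset.mem_filter.1 (Finset.mem_coe.1 hq)).2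
    refine Prod.ext hpq ?_
    rw [hpq] at hp'
    have hv2 : (v : ℤ) ^ 2 ≠ 0 := by positivity
    have : (v : ℤ) ^ 2 * p.2 = (v : ℤ) ^ 2 * q.2 := by linarith
    exact_mod_cast mul_left_cancel₀ hv2 this
  rw [← Finset.card_image_of_injOn hinj]
  have h := card_le_of_pairwise_modEq (N := N) (r := v ^ 2) (by positivity)
    (S := P.image Prod.fst) ?_ ?_
  · simpa using h
  · intro a ha
    obtain ⟨p, hp, rfl⟩ := Finset.mem_image.1 ha
    exact (Finset.mem_product.1 (Finset.mem_filter.1 hp).1).1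
  · intro a ha b hb
    obtain ⟨p, hp, rfl⟩ := Finset.mem_image.1 ha
    obtain ⟨q, hq, rfl⟩ := Finset.mem_image.1 hb
    have hp' := (Finset.mem_filter.1 hp).2
    have hq' := (Finset.mem_filter.1 hq).2
    have hco : IsCoprime ((v : ℤ) ^ 2) ((u : ℤ) ^ 2) :=
      (Nat.isCoprime_iff_coprime.2 huv.symm).pow
    rw [Nat.modEq_iff_dvd]
    push_cast
    apply hco.dvd_of_dvd_mul_left
    exact ⟨(q.2 : ℤ) - p.2, by linarith⟩

/-- The weight `1` at `0` and `H / d` at `d ≠ 0`. -/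
noncomputable def gapWeight (H d : ℕ) : ℝ := if d = 0 then 1 else (H : ℝ) / d

lemma gapWeight_nonneg (H d : ℕ) : 0 ≤ gapWeight H d := by
  unfold gapWeight
  split_ifs <;> positivity

lemma sum_gapWeight_le (H : ℕ) {g : ℕ} (hg : 0 < g) (T : ℕ) :
    ∑ k ∈ Finset.range (T + 1), gapWeight H (g ^ 2 * k) ≤
      1 + H / (g : ℝ) ^ 2 * (1 + Real.log T) := by
  rw [Finset.sum_range_succ']
  have h0 : gapWeight H (g ^ 2 * 0) = 1 := by simp [gapWeight]
  have h1 : ∀ k ∈ Finset.range T, gapWeight H (g ^ 2 * (k + 1)) =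
      H / (g : ℝ) ^ 2 * ((k : ℝ) + 1)⁻¹ := by
    intro k _
    unfold gapWeight
    rw [if_neg (by positivity)]
    push_cast
    field_simp
  rw [h0, Finset.sum_congr rfl h1, ← Finset.mul_sum, add_comm]
  have h2 := harmonic_le_one_add_log T
  simp only [harmonic, Rat.cast_sum, Rat.cast_inv, Rat.cast_natCast] at h2
  push_cast at h2
  gcongr

lemma sum_gapWeight_sub_le (H N : ℕ) {n m T : ℕ} (hn : 0 < n) (hm : 0 < m)
    (hnT : n ^ 2 * (2 * N) ≤ T) (hmT : m ^ 2 * (2 * N) ≤ T) :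
    ∑ p ∈ (Finset.Ioc N (2 * N)) ×ˢ (Finset.Ioc N (2 * N)),
      gapWeight H ((n : ℤ) ^ 2 * p.1 - (m : ℤ) ^ 2 * p.2).natAbs ≤
      2 * (N * (n.gcd m : ℝ) ^ 2 / (m : ℝ) ^ 2 + 1) *
        (1 + H / (n.gcd m : ℝ) ^ 2 * (1 + Real.log T)) := by
  obtain ⟨u, v, huv, hnu, hmv⟩ := Nat.exists_coprime n m
  set g := n.gcd m with hg_def
  have hg : 0 < g := Nat.gcd_pos_of_pos_left m hn
  have hv : 0 < v := Nat.pos_of_mul_pos_right (hmv ▸ hm)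
  have hv' : (0 : ℝ) < v := by exact_mod_cast hv
  have hg' : (0 : ℝ) < g := by exact_mod_cast hg
  set φ : ℕ × ℕ → ℕ := fun p => ((u : ℤ) ^ 2 * p.1 - (v : ℤ) ^ 2 * p.2).natAbs with hφ
  have hφ' : ∀ p : ℕ × ℕ, ((n : ℤ) ^ 2 * p.1 - (m : ℤ) ^ 2 * p.2).natAbs = g ^ 2 * φ p := by
    intro p
    have : (n : ℤ) ^ 2 * p.1 - (m : ℤ) ^ 2 * p.2 =
        (g : ℤ) ^ 2 * ((u : ℤ) ^ 2 * p.1 - (v : ℤ) ^ 2 * p.2) := by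
      rw [hnu, hmv]
      push_cast
      ring
    rw [this, Int.natAbs_mul, Int.natAbs_pow, Int.natAbs_natCast]
  have hmaps : ∀ p ∈ (Finset.Ioc N (2 * N)) ×ˢ (Finset.Ioc N (2 * N)),
      φ p ∈ Finset.range (T + 1) := by
    intro p hp
    obtain ⟨h1, h2⟩ := Finset.mem_product.1 hp
    rw [Finset.mem_Ioc] at h1 h2
    have h3 : n ^ 2 * p.1 ≤ T := (Nat.mul_le_mul_left _ h1.2).trans hnT
    have h4 : m ^ 2 * p.2 ≤ T := (Nat.mul_le_mul_left _ h2.2).trans hmT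
    have h5 : φ p ≤ g ^ 2 * φ p := Nat.le_mul_of_pos_left _ (by positivity)
    rw [← hφ'] at h5
    zify at h3 h4
    rw [Finset.mem_range]
    have h6 : (0 : ℤ) ≤ (n : ℤ) ^ 2 * p.1 := by positivity
    have h7 : (0 : ℤ) ≤ (m : ℤ) ^ 2 * p.2 := by positivity
    omega
  simp_rw [hφ']
  rw [← Finset.sum_fiberwise_of_maps_to hmaps]
  have hfib : ∀ k ∈ Finset.range (T + 1),
      ∑ p ∈ ((Finset.Ioc N (2 * N)) ×ˢ (Finset.Ioc N (2 * N))).filter (fun p => φ p = k),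
        gapWeight H (g ^ 2 * φ p) ≤
      2 * (N * (g : ℝ) ^ 2 / (m : ℝ) ^ 2 + 1) * gapWeight H (g ^ 2 * k) := by
    intro k _
    have hcongr : ∀ p ∈ ((Finset.Ioc N (2 * N)) ×ˢ (Finset.Ioc N (2 * N))).filter
        (fun p => φ p = k), gapWeight H (g ^ 2 * φ p) = gapWeight H (g ^ 2 * k) := by
      intro p hp
      rw [(Finset.mem_filter.1 hp).2]
    rw [Finset.sum_congr rfl hcongr, Finset.sum_const, nsmul_eq_mul]
    apply mul_le_mul_of_nonneg_right _ (gapWeight_nonneg _ _)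
    have h1 := card_filter_sub_eq_le N hv huv k
    have h2 := card_filter_sub_eq_le N hv huv (-k)
    have hsub : ((Finset.Ioc N (2 * N)) ×ˢ (Finset.Ioc N (2 * N))).filter (fun p => φ p = k) ⊆
        ((Finset.Ioc N (2 * N)) ×ˢ (Finset.Ioc N (2 * N))).filter
          (fun p => (u : ℤ) ^ 2 * p.1 - (v : ℤ) ^ 2 * p.2 = k) ∪
        ((Finset.Ioc N (2 * N)) ×ˢ (Finset.Ioc N (2 * N))).filter
          (fun p => (u : ℤ) ^ 2 * p.1 - (v : ℤ) ^ 2 * p.2 = -k) := by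
      intro p hp
      obtain ⟨hp1, hp2⟩ := Finset.mem_filter.1 hp
      rw [Finset.mem_union, Finset.mem_filter, Finset.mem_filter]
      rcases Int.natAbs_eq_iff.1 hp2 with h | h
      · exact Or.inl ⟨hp1, h⟩
      · exact Or.inr ⟨hp1, h⟩
    have h3 : (((((Finset.Ioc N (2 * N)) ×ˢ (Finset.Ioc N (2 * N))).filter
        (fun p => φ p = k)).card : ℕ) : ℝ) ≤ _ :=
      Nat.cast_le.2 ((Finset.card_le_card hsub).trans (Finset.card_union_le _ _))
    have h4 : (N : ℝ) * (g : ℝ) ^ 2 / (m : ℝ) ^ 2 = N / (v : ℝ) ^ 2 := by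
      rw [hmv]
      push_cast
      field_simp
    rw [h4]
    push_cast at h3
    linarith
  refine (Finset.sum_le_sum hfib).trans ?_
  rw [← Finset.mul_sum]
  exact mul_le_mul_of_nonneg_left (sum_gapWeight_le H hg T) (by positivity)

lemma sum_gcd_sq_le (M : ℕ) :
    ∑ n ∈ Finset.Ioc 0 M, ∑ m ∈ Finset.Ioc 0 M, (n.gcd m : ℝ) ^ 2 ≤ (M : ℝ) ^ 3 := by
  have h1 : ∀ n ∈ Finset.Ioc 0 M, ∀ m ∈ Finset.Ioc 0 M, (n.gcd m : ℝ) ^ 2 ≤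
      ∑ g ∈ Finset.Ioc 0 M, if g ∣ n ∧ g ∣ m then (g : ℝ) ^ 2 else 0 := by
    intro n hn m _
    rw [Finset.mem_Ioc] at hn
    have hmem : n.gcd m ∈ Finset.Ioc 0 M := Finset.mem_Ioc.2
      ⟨Nat.gcd_pos_of_pos_left _ hn.1, (Nat.gcd_le_left _ hn.1).trans hn.2⟩
    have h := Finset.single_le_sum
      (f := fun g : ℕ => if g ∣ n ∧ g ∣ m then (g : ℝ) ^ 2 else 0)
      (fun g _ => by positivity) hmem
    simpa [Nat.gcd_dvd_left, Nat.gcd_dvd_right] using h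
  have h2 : ∀ g ∈ Finset.Ioc 0 M, (∑ n ∈ Finset.Ioc 0 M, ∑ m ∈ Finset.Ioc 0 M,
      if g ∣ n ∧ g ∣ m then (g : ℝ) ^ 2 else 0) ≤ (M : ℝ) ^ 2 := by
    intro g hg
    have hg0 : (0 : ℝ) < g := by exact_mod_cast (Finset.mem_Ioc.1 hg).1
    have h3 : ∀ n m : ℕ, (if g ∣ n ∧ g ∣ m then (g : ℝ) ^ 2 else 0) =
        (if g ∣ n then (g : ℝ) else 0) * (if g ∣ m then (g : ℝ) else 0) := by
      intro n m
      by_cases h : g ∣ n <;> by_cases h' : g ∣ m <;> simp [h, h', sq]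
    simp_rw [h3]
    rw [← Finset.sum_mul_sum, ← sq]
    apply pow_le_pow_left₀ (Finset.sum_nonneg fun n _ => by positivity)
    rw [← Finset.sum_filter, Finset.sum_const, Nat.Ioc_filter_dvd_card_eq_div, nsmul_eq_mul]
    exact_mod_cast Nat.div_mul_le_self M g
  calc _ ≤ ∑ n ∈ Finset.Ioc 0 M, ∑ m ∈ Finset.Ioc 0 M,
        ∑ g ∈ Finset.Ioc 0 M, (if g ∣ n ∧ g ∣ m then (g : ℝ) ^ 2 else 0) :=
      Finset.sum_le_sum fun n hn => Finset.sum_le_sum fun m hm => h1 n hn m hm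
    _ = ∑ g ∈ Finset.Ioc 0 M, ∑ n ∈ Finset.Ioc 0 M, ∑ m ∈ Finset.Ioc 0 M,
        (if g ∣ n ∧ g ∣ m then (g : ℝ) ^ 2 else 0) := by
      simp_rw [Finset.sum_comm (s := Finset.Ioc 0 M) (t := Finset.Ioc 0 M)
        (f := fun m g => if g ∣ _ ∧ g ∣ m then (g : ℝ) ^ 2 else 0)]
      rw [Finset.sum_comm]
    _ ≤ ∑ g ∈ Finset.Ioc 0 M, (M : ℝ) ^ 2 := Finset.sum_le_sum h2
    _ = (M : ℝ) ^ 3 := by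
      rw [Finset.sum_const, Nat.card_Ioc, tsub_zero, nsmul_eq_mul]
      ring

lemma sum_sum_gapWeight_le {H N : ℕ} (hH : 0 < H) :
    ∑ n ∈ Finset.Ico H (2 * H), ∑ m ∈ Finset.Ico H (2 * H),
      ∑ p ∈ (Finset.Ioc N (2 * N)) ×ˢ (Finset.Ioc N (2 * N)),
        gapWeight H ((n : ℤ) ^ 2 * p.1 - (m : ℤ) ^ 2 * p.2).natAbs ≤
      22 * (1 + Real.log (8 * (H : ℝ) ^ 2 * N)) * (H * N + (H : ℝ) ^ 3) := by
  have hH1 : (1 : ℝ) ≤ H := by exact_mod_cast hH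
  set L : ℝ := 1 + Real.log (8 * (H : ℝ) ^ 2 * N) with hL
  have hL1 : 1 ≤ L := by
    have h := Real.log_natCast_nonneg (8 * H ^ 2 * N)
    push_cast at h
    linarith
  have hN0 : (0 : ℝ) ≤ N := by positivity
  have hterm : ∀ n ∈ Finset.Ico H (2 * H), ∀ m ∈ Finset.Ico H (2 * H),
      ∑ p ∈ (Finset.Ioc N (2 * N)) ×ˢ (Finset.Ioc N (2 * N)),
        gapWeight H ((n : ℤ) ^ 2 * p.1 - (m : ℤ) ^ 2 * p.2).natAbs ≤
      2 * N / (H : ℝ) ^ 2 * (n.gcd m : ℝ) ^ 2 + (2 + 2 * (N / H) * L + 2 * H * L) := by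
    intro n hn m hm
    rw [Finset.mem_Ico] at hn hm
    have hn0 : 0 < n := by omega
    have hm0 : 0 < m := by omega
    have h8 : (2 * H) ^ 2 * (2 * N) = 8 * H ^ 2 * N := by ring
    have h := sum_gapWeight_sub_le H N hn0 hm0
      (T := 8 * H ^ 2 * N) (h8 ▸ Nat.mul_le_mul_right _ (Nat.pow_le_pow_left hn.2.le 2))
      (h8 ▸ Nat.mul_le_mul_right _ (Nat.pow_le_pow_left hm.2.le 2))
    refine h.trans ?_
    push_cast
    rw [← hL]
    have hg : (1 : ℝ) ≤ n.gcd m := by exact_mod_cast Nat.gcd_pos_of_pos_left m hn0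
    set g : ℝ := (n.gcd m : ℝ)
    have hmH : (H : ℝ) ≤ m := by exact_mod_cast hm.1
    have h1 : N * g ^ 2 / (m : ℝ) ^ 2 ≤ N * g ^ 2 / (H : ℝ) ^ 2 := by gcongr
    have h2 : H / g ^ 2 * L ≤ H * L := by
      gcongr
      exact div_le_self (by positivity) (by nlinarith)
    calc 2 * (N * g ^ 2 / (m : ℝ) ^ 2 + 1) * (1 + H / g ^ 2 * L)
        ≤ 2 * (N * g ^ 2 / (H : ℝ) ^ 2 + 1) * (1 + H / g ^ 2 * L) := by gcongr
      _ = 2 * N / (H : ℝ) ^ 2 * g ^ 2 + (2 + 2 * (N / H) * L + 2 * (H / g ^ 2 * L)) := by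
        field_simp
        ring
      _ ≤ _ := by linarith
  have hgcd : ∑ n ∈ Finset.Ico H (2 * H), ∑ m ∈ Finset.Ico H (2 * H), (n.gcd m : ℝ) ^ 2 ≤
      8 * (H : ℝ) ^ 3 := by
    have hsub : Finset.Ico H (2 * H) ⊆ Finset.Ioc 0 (2 * H) := by
      intro n hn
      rw [Finset.mem_Ico] at hn
      rw [Finset.mem_Ioc]
      omega
    have h := sum_gcd_sq_le (2 * H)
    push_cast at h
    calc _ ≤ ∑ n ∈ Finset.Ico H (2 * H), ∑ m ∈ Finset.Ioc 0 (2 * H), (n.gcd m : ℝ) ^ 2 :=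
          Finset.sum_le_sum fun n _ => Finset.sum_le_sum_of_subset_of_nonneg hsub
            fun _ _ _ => sq_nonneg _
      _ ≤ _ := Finset.sum_le_sum_of_subset_of_nonneg hsub
            fun _ _ _ => Finset.sum_nonneg fun _ _ => sq_nonneg _
      _ ≤ _ := h
      _ = _ := by ring
  have hcard : (Finset.Ico H (2 * H)).card = H := by
    rw [Nat.card_Ico]
    omega
  refine (Finset.sum_le_sum fun n hn => Finset.sum_le_sum fun m hm => hterm n hn m hm).trans ?_
  simp only [Finset.sum_add_distrib, ← Finset.mul_sum, Finset.sum_const, hcard, nsmul_eq_mul]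
  have h1 : 2 * N / (H : ℝ) ^ 2 * ∑ n ∈ Finset.Ico H (2 * H), ∑ m ∈ Finset.Ico H (2 * H),
      (n.gcd m : ℝ) ^ 2 ≤ 16 * (H * N) := by
    refine (mul_le_mul_of_nonneg_left hgcd (by positivity)).trans_eq ?_
    field_simp
    ring
  have h2 : (H : ℝ) * (H * (2 * (N / H) * L)) = 2 * (H * N) * L := by
    field_simp
  have h3 : (H : ℝ) ^ 2 ≤ (H : ℝ) ^ 3 := pow_le_pow_right₀ hH1 (by norm_num)
  have h4 : (H : ℝ) * N ≤ H * N * L := le_mul_of_one_le_right (by positivity) hL1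
  have h5 : (H : ℝ) ^ 3 ≤ (H : ℝ) ^ 3 * L := le_mul_of_one_le_right (by positivity) hL1
  have h6 : (0 : ℝ) ≤ (H : ℝ) ^ 3 * L := by positivity
  have h7 : (0 : ℝ) ≤ H * N * L := by positivity
  nlinarith

end PairCount

section DyadicBlock

/-- The frequency of `y ↦ cos (2 π n √a y)`, attached to the pair `(n, a)`. -/
noncomputable def sqrtFreq (p : ℕ × ℕ) : ℝ := 2 * Real.pi * p.1 * √p.2

lemma sqrtFreq_nonneg (p : ℕ × ℕ) : 0 ≤ sqrtFreq p := by
  unfold sqrtFreq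
  positivity

lemma sqrtFreq_le {H N : ℕ} {p : ℕ × ℕ} (h1 : p.1 ≤ 2 * H) (h2 : p.2 ≤ 2 * N) :
    sqrtFreq p ≤ 6 * Real.pi * H * √N := by
  unfold sqrtFreq
  have h1' : (p.1 : ℝ) ≤ 2 * H := by exact_mod_cast h1
  have h2' : √(p.2 : ℝ) ≤ 3 / 2 * √N := by
    rw [Real.sqrt_le_left (by positivity), mul_pow, Real.sq_sqrt (by positivity)]
    have : (p.2 : ℝ) ≤ 2 * N := by exact_mod_cast h2
    have hN : (0 : ℝ) ≤ N := by positivity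
    linarith
  calc 2 * Real.pi * p.1 * √p.2 ≤ 2 * Real.pi * (2 * H) * (3 / 2 * √N) := by gcongr
    _ = _ := by ring

lemma two_div_abs_sqrtFreq_sub_le {H N : ℕ} {p q : ℕ × ℕ} (hp1 : p.1 ≤ 2 * H)
    (hp2 : p.2 ≤ 2 * N) (hq1 : q.1 ≤ 2 * H) (hq2 : q.2 ≤ 2 * N)
    (hne : (p.1 : ℤ) ^ 2 * p.2 - (q.1 : ℤ) ^ 2 * q.2 ≠ 0) :
    sqrtFreq p ≠ sqrtFreq q ∧ 2 / |sqrtFreq p - sqrtFreq q| ≤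
      2 * √N * gapWeight H ((p.1 : ℤ) ^ 2 * p.2 - (q.1 : ℤ) ^ 2 * q.2).natAbs := by
  set D := (p.1 : ℤ) ^ 2 * p.2 - (q.1 : ℤ) ^ 2 * q.2 with hD
  have hsq : ∀ r : ℕ × ℕ, sqrtFreq r ^ 2 = 4 * Real.pi ^ 2 * ((r.1 : ℝ) ^ 2 * r.2) := by
    intro r
    unfold sqrtFreq
    rw [mul_pow, Real.sq_sqrt (by positivity)]
    ring
  have hmul : (sqrtFreq p - sqrtFreq q) * (sqrtFreq p + sqrtFreq q) =
      4 * Real.pi ^ 2 * (D : ℝ) := by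
    rw [hD]
    push_cast
    linear_combination hsq p - hsq q
  have hD0 : (D : ℝ) ≠ 0 := by exact_mod_cast hne
  have hpi := Real.pi_pos
  have hmul0 : (sqrtFreq p - sqrtFreq q) * (sqrtFreq p + sqrtFreq q) ≠ 0 := by
    rw [hmul]
    positivity
  have hsub := left_ne_zero_of_mul hmul0
  have hadd : 0 < sqrtFreq p + sqrtFreq q :=
    lt_of_le_of_ne (add_nonneg (sqrtFreq_nonneg p) (sqrtFreq_nonneg q))
      (right_ne_zero_of_mul hmul0).symm
  refine ⟨sub_ne_zero.1 hsub, ?_⟩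
  have habs : |sqrtFreq p - sqrtFreq q| * (sqrtFreq p + sqrtFreq q) =
      4 * Real.pi ^ 2 * |(D : ℝ)| := by
    have := congrArg abs hmul
    rwa [abs_mul, abs_mul, abs_of_pos hadd, abs_of_pos (by positivity : 0 < 4 * Real.pi ^ 2)]
      at this
  unfold gapWeight
  rw [if_neg (by simpa using hne), Nat.cast_natAbs, Int.cast_abs, mul_div_assoc',
    div_le_div_iff₀ (abs_pos.2 hsub) (abs_pos.2 hD0)]
  have hle : sqrtFreq p + sqrtFreq q ≤ 12 * Real.pi * H * √N := by
    have a1 := sqrtFreq_le hp1 hp2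
    have a2 := sqrtFreq_le hq1 hq2
    linarith
  have h1 := mul_le_mul_of_nonneg_left hle (abs_nonneg (sqrtFreq p - sqrtFreq q))
  rw [habs] at h1
  have h2 : Real.pi * |(D : ℝ)| ≤ 3 * (H * √N * |sqrtFreq p - sqrtFreq q|) := by
    have : (4 * Real.pi) * (Real.pi * |(D : ℝ)|) ≤
        (4 * Real.pi) * (3 * (H * √N * |sqrtFreq p - sqrtFreq q|)) := by linarith
    exact le_of_mul_le_mul_left this (by positivity)
  nlinarith [Real.pi_gt_three, abs_nonneg (D : ℝ)]

lemma four_mul_sqrt_inv_le_sqrt_sub {N k : ℕ} (hk : k < N) :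
    (4 * √(N : ℝ))⁻¹ ≤ √((N + 1 + (k + 1 : ℕ) : ℕ) : ℝ) - √((N + 1 + k : ℕ) : ℝ) := by
  have hN : (1 : ℝ) ≤ N := by exact_mod_cast (by omega : 1 ≤ N)
  have hk' : (k : ℝ) + 1 ≤ N := by exact_mod_cast hk
  have hk0 : (0 : ℝ) ≤ k := by positivity
  have hle : ∀ x : ℝ, x ≤ 4 * N → √x ≤ 2 * √N := by
    intro x hx
    rw [Real.sqrt_le_left (by positivity), mul_pow, Real.sq_sqrt (by positivity)]
    linarith
  push_cast
  set s := √((N : ℝ) + 1 + (k + 1))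
  set t := √((N : ℝ) + 1 + k)
  have hs : s ≤ 2 * √N := hle _ (by linarith)
  have ht : t ≤ 2 * √N := hle _ (by linarith)
  have hN0 : 0 < √(N : ℝ) := Real.sqrt_pos.2 (by linarith)
  have hmul : (s - t) * (s + t) = 1 := by
    have hs2 : s ^ 2 = (N : ℝ) + 1 + (k + 1) := Real.sq_sqrt (by positivity)
    have ht2 : t ^ 2 = (N : ℝ) + 1 + k := Real.sq_sqrt (by positivity)
    linear_combination hs2 - ht2
  have hst : 0 < s - t := sub_pos.2 (Real.sqrt_lt_sqrt (by positivity) (by linarith))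
  rw [inv_le_iff_one_le_mul₀ (by positivity)]
  nlinarith

lemma sum_gapWeight_product_le (H N : ℕ) {A : Finset ℕ} (hA : A ⊆ Finset.Icc (N + 1) (2 * N)) :
    ∑ p ∈ Finset.Ico H (2 * H) ×ˢ A, ∑ q ∈ Finset.Ico H (2 * H) ×ˢ A,
      gapWeight H ((p.1 : ℤ) ^ 2 * p.2 - (q.1 : ℤ) ^ 2 * q.2).natAbs ≤
    ∑ n ∈ Finset.Ico H (2 * H), ∑ m ∈ Finset.Ico H (2 * H),
      ∑ p ∈ (Finset.Ioc N (2 * N)) ×ˢ (Finset.Ioc N (2 * N)),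
        gapWeight H ((n : ℤ) ^ 2 * p.1 - (m : ℤ) ^ 2 * p.2).natAbs := by
  simp_rw [Finset.sum_product]
  apply Finset.sum_le_sum
  intro n _
  rw [Finset.sum_comm]
  apply Finset.sum_le_sum
  intro m _
  have hA' : A ⊆ Finset.Ioc N (2 * N) := fun a ha => by
    have := Finset.mem_Icc.1 (hA ha)
    exact Finset.mem_Ioc.2 ⟨by omega, this.2⟩
  refine (Finset.sum_le_sum fun a _ => Finset.sum_le_sum_of_subset_of_nonneg hA'
    fun _ _ _ => gapWeight_nonneg _ _).trans ?_
  exact Finset.sum_le_sum_of_subset_of_nonneg hA'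
    fun _ _ _ => Finset.sum_nonneg fun _ _ => gapWeight_nonneg _ _

lemma sum_sq_cos_block_le_gapWeight {H N : ℕ} (hH : 0 < H) (hN : 0 < N) {A : Finset ℕ}
    (hA : A ⊆ Finset.Icc (N + 1) (2 * N)) (c : ℕ → ℝ) {M : ℝ}
    (hc : ∀ n ∈ Finset.Ico H (2 * H), |c n| ≤ M) :
    ∑ b ∈ Finset.Icc (N + 1) (2 * N),
      (∑ p ∈ Finset.Ico H (2 * H) ×ˢ A, c p.1 * Real.cos (sqrtFreq p * √b)) ^ 2 ≤
    800 * H * N * M ^ 2 * ∑ p ∈ Finset.Ico H (2 * H) ×ˢ A, ∑ q ∈ Finset.Ico H (2 * H) ×ˢ A,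
      gapWeight H ((p.1 : ℤ) ^ 2 * p.2 - (q.1 : ℤ) ^ 2 * q.2).natAbs := by
  set s := Finset.Ico H (2 * H) ×ˢ A with hs
  set Q := ∑ p ∈ s, ∑ q ∈ s,
      gapWeight H ((p.1 : ℤ) ^ 2 * p.2 - (q.1 : ℤ) ^ 2 * q.2).natAbs with hQ
  have hQ0 : 0 ≤ Q := Finset.sum_nonneg fun _ _ => Finset.sum_nonneg fun _ _ =>
    gapWeight_nonneg _ _
  have hN' : (1 : ℝ) ≤ N := by exact_mod_cast hN
  have hH' : (1 : ℝ) ≤ H := by exact_mod_cast hH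
  have hr0 : 0 < √(N : ℝ) := Real.sqrt_pos.2 (by linarith)
  have hmem : ∀ p ∈ s, p.1 ≤ 2 * H ∧ p.2 ≤ 2 * N := by
    intro p hp
    obtain ⟨h1, h2⟩ := Finset.mem_product.1 hp
    exact ⟨(Finset.mem_Ico.1 h1).2.le, (Finset.mem_Icc.1 (hA h2)).2⟩
  have hc' : ∀ p ∈ s, |c p.1| ≤ M := fun p hp => hc _ (Finset.mem_product.1 hp).1
  set F : ℝ → ℝ := fun y => ∑ p ∈ s, c p.1 * Real.cos (sqrtFreq p * y) with hF
  set F' : ℝ → ℝ := fun y => ∑ p ∈ s, (-(c p.1 * sqrtFreq p)) * Real.sin (sqrtFreq p * y) with hF'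
  have hderiv : ∀ y, HasDerivAt F (F' y) y := by
    intro y
    apply HasDerivAt.fun_sum
    intro p _
    have h := (((hasDerivAt_id y).const_mul (sqrtFreq p)).cos).const_mul (c p.1)
    convert! h using 1
    simp
    ring
  have hcont : Continuous F' := by fun_prop
  set y : ℕ → ℝ := fun k => √((N + 1 + k : ℕ) : ℝ) with hy
  have hlen : y N - y 0 ≤ 2 * √(N : ℝ) := by
    have h1 : y N ≤ 2 * √(N : ℝ) := by
      rw [hy]
      simp only
      rw [Real.sqrt_le_left (by positivity), mul_pow, Real.sq_sqrt (by positivity)]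
      push_cast
      linarith
    have h2 : 0 ≤ y 0 := Real.sqrt_nonneg _
    linarith
  have hymono : y 0 ≤ y N := Real.sqrt_le_sqrt (by push_cast; linarith)
  set K : ℕ × ℕ → ℕ × ℕ → ℝ := fun p q =>
    2 * √(N : ℝ) * gapWeight H ((p.1 : ℤ) ^ 2 * p.2 - (q.1 : ℤ) ^ 2 * q.2).natAbs with hK
  have hKsum : ∑ p ∈ s, ∑ q ∈ s, K p q = 2 * √(N : ℝ) * Q := by
    simp only [hK, hQ, Finset.mul_sum]
  have hKcos : ∀ p ∈ s, ∀ q ∈ s,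
      |∫ t in (y 0)..(y N), Real.cos (sqrtFreq p * t) * Real.cos (sqrtFreq q * t)| ≤ K p q := by
    intro p hp q hq
    by_cases hne : (p.1 : ℤ) ^ 2 * p.2 - (q.1 : ℤ) ^ 2 * q.2 = 0
    · refine (abs_integral_mul_le_sub (fun t => Real.abs_cos_le_one _)
        (fun t => Real.abs_cos_le_one _) hymono).trans (hlen.trans_eq ?_)
      simp [hK, gapWeight, hne]
    · obtain ⟨h1, h2⟩ := two_div_abs_sqrtFreq_sub_le (hmem p hp).1 (hmem p hp).2
        (hmem q hq).1 (hmem q hq).2 hne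
      exact (abs_integral_cos_mul_cos_le (sqrtFreq_nonneg p) (sqrtFreq_nonneg q) h1).trans h2
  have hKsin : ∀ p ∈ s, ∀ q ∈ s,
      |∫ t in (y 0)..(y N), Real.sin (sqrtFreq p * t) * Real.sin (sqrtFreq q * t)| ≤ K p q := by
    intro p hp q hq
    by_cases hne : (p.1 : ℤ) ^ 2 * p.2 - (q.1 : ℤ) ^ 2 * q.2 = 0
    · refine (abs_integral_mul_le_sub (fun t => Real.abs_sin_le_one _)
        (fun t => Real.abs_sin_le_one _) hymono).trans (hlen.trans_eq ?_)
      simp [hK, gapWeight, hne]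
    · obtain ⟨h1, h2⟩ := two_div_abs_sqrtFreq_sub_le (hmem p hp).1 (hmem p hp).2
        (hmem q hq).1 (hmem q hq).2 hne
      exact (abs_integral_sin_mul_sin_le (sqrtFreq_nonneg p) (sqrtFreq_nonneg q) h1).trans h2
  have hIF : ∫ t in (y 0)..(y N), F t ^ 2 ≤ M ^ 2 * (2 * √(N : ℝ) * Q) := by
    rw [← hKsum]
    exact integral_sum_sq_le s (fun p => c p.1) (fun p t => Real.cos (sqrtFreq p * t))
      (fun p => by fun_prop) hc' K hKcos
  have hIF' : ∫ t in (y 0)..(y N), F' t ^ 2 ≤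
      (M * (6 * Real.pi * H * √N)) ^ 2 * (2 * √(N : ℝ) * Q) := by
    rw [← hKsum]
    refine integral_sum_sq_le s (fun p => -(c p.1 * sqrtFreq p))
      (fun p t => Real.sin (sqrtFreq p * t)) (fun p => by fun_prop) ?_ K hKsin
    intro p hp
    rw [abs_neg, abs_mul, abs_of_nonneg (sqrtFreq_nonneg p)]
    exact mul_le_mul (hc' p hp) (sqrtFreq_le (hmem p hp).1 (hmem p hp).2) (sqrtFreq_nonneg p)
      ((abs_nonneg _).trans (hc' p hp))
  have hsum : ∑ b ∈ Finset.Icc (N + 1) (2 * N), F (√b) ^ 2 =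
      ∑ k ∈ Finset.range N, F (y k) ^ 2 := by
    have : Finset.Icc (N + 1) (2 * N) = Finset.Ico (N + 1) (N + 1 + N) := by
      ext b
      simp only [Finset.mem_Icc, Finset.mem_Ico]
      omega
    rw [this, Finset.sum_Ico_eq_sum_range]
    simp [hy]
  have hX : 0 < H * √(N : ℝ) := by positivity
  have hG := sum_sq_le_integral_of_hasDerivAt hderiv hcont (y := y) (n := N)
    (l := (4 * √(N : ℝ))⁻¹) (X := H * √(N : ℝ)) (by positivity) hX
    (fun k hk => four_mul_sqrt_inv_le_sqrt_sub hk)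
  rw [inv_inv] at hG
  change ∑ b ∈ Finset.Icc (N + 1) (2 * N), F (√b) ^ 2 ≤ _
  rw [hsum]
  have hsqN : √(N : ℝ) * √(N : ℝ) = N := Real.mul_self_sqrt (by linarith)
  have hpi : Real.pi ^ 2 ≤ 10 := by nlinarith [Real.pi_lt_d2, Real.pi_pos]
  set I1 := ∫ t in (y 0)..(y N), F t ^ 2
  set I2 := ∫ t in (y 0)..(y N), F' t ^ 2
  have hI1 : 0 ≤ I1 := intervalIntegral.integral_nonneg hymono fun _ _ => sq_nonneg _
  have e1 : (4 * √(N : ℝ) + H * √N) * I1 ≤ 10 * H * N * M ^ 2 * Q := by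
    calc (4 * √(N : ℝ) + H * √N) * I1
        ≤ (5 * H * √(N : ℝ)) * (M ^ 2 * (2 * √(N : ℝ) * Q)) := by
          apply mul_le_mul _ hIF hI1 (by positivity)
          nlinarith
      _ = 10 * H * (√(N : ℝ) * √(N : ℝ)) * M ^ 2 * Q := by ring
      _ = _ := by rw [hsqN]
  have e2 : (H * √(N : ℝ))⁻¹ * I2 ≤ 720 * H * N * M ^ 2 * Q := by
    calc (H * √(N : ℝ))⁻¹ * I2
        ≤ (H * √(N : ℝ))⁻¹ * ((M * (6 * Real.pi * H * √N)) ^ 2 * (2 * √(N : ℝ) * Q)) := by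
          gcongr
      _ = Real.pi ^ 2 * (72 * H * (√(N : ℝ) * √(N : ℝ)) * M ^ 2 * Q) := by
          field_simp
          ring
      _ ≤ 10 * (72 * H * (√(N : ℝ) * √(N : ℝ)) * M ^ 2 * Q) := by gcongr
      _ = _ := by
          rw [hsqN]
          ring
  have e3 : 0 ≤ H * N * M ^ 2 * Q := by positivity
  linarith

lemma sum_sq_cos_block_le {H N : ℕ} (hH : 0 < H) (hN : 0 < N) {A : Finset ℕ}
    (hA : A ⊆ Finset.Icc (N + 1) (2 * N)) (c : ℕ → ℝ)
    (hc1 : ∀ n ∈ Finset.Ico H (2 * H), |c n| ≤ 1 / H)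
    (hc2 : ∀ n ∈ Finset.Ico H (2 * H), |c n| ≤ √N / (H : ℝ) ^ 2) :
    ∑ b ∈ Finset.Icc (N + 1) (2 * N),
      (∑ p ∈ Finset.Ico H (2 * H) ×ˢ A, c p.1 * Real.cos (sqrtFreq p * √b)) ^ 2 ≤
    35200 * (N : ℝ) ^ 2 * (1 + Real.log (8 * (H : ℝ) ^ 2 * N)) := by
  have hN' : (0 : ℝ) < N := by exact_mod_cast hN
  have hH' : (0 : ℝ) < H := by exact_mod_cast hH
  set M : ℝ := min (1 / H) (√N / (H : ℝ) ^ 2) with hM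
  have hM0 : 0 ≤ M := by positivity
  have hM1 : M ^ 2 * (H : ℝ) ^ 2 ≤ 1 := by
    rw [← mul_pow]
    apply pow_le_one₀ (by positivity)
    exact (le_div_iff₀ hH').1 (min_le_left _ _)
  have hM2 : M ^ 2 * (H : ℝ) ^ 4 ≤ N := by
    have h1 : M * (H : ℝ) ^ 2 ≤ √N := (le_div_iff₀ (by positivity)).1 (min_le_right _ _)
    calc M ^ 2 * (H : ℝ) ^ 4 = (M * (H : ℝ) ^ 2) ^ 2 := by ring
      _ ≤ √(N : ℝ) ^ 2 := pow_le_pow_left₀ (by positivity) h1 2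
      _ = N := Real.sq_sqrt hN'.le
  have hL : 0 ≤ 1 + Real.log (8 * (H : ℝ) ^ 2 * N) := by
    have h := Real.log_natCast_nonneg (8 * H ^ 2 * N)
    push_cast at h
    linarith
  set L := 1 + Real.log (8 * (H : ℝ) ^ 2 * N) with hLdef
  have h1 := sum_sq_cos_block_le_gapWeight hH hN hA c (M := M)
    fun n hn => le_min (hc1 n hn) (hc2 n hn)
  have h2 := (sum_gapWeight_product_le H N hA).trans (sum_sum_gapWeight_le hH)
  refine h1.trans ((mul_le_mul_of_nonneg_left h2 (by positivity)).trans ?_)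
  rw [← hLdef]
  calc 800 * H * N * M ^ 2 * (22 * L * (H * N + (H : ℝ) ^ 3))
      = 17600 * L * ((M ^ 2 * (H : ℝ) ^ 2) * (N : ℝ) ^ 2 + (M ^ 2 * (H : ℝ) ^ 4) * N) := by ring
    _ ≤ 17600 * L * (1 * (N : ℝ) ^ 2 + N * N) := by gcongr
    _ = _ := by ring

end DyadicBlock

section Discrepancy

lemma abs_sub_sum_range_le_of_hasSum {f : ℕ → ℝ} {s K : ℝ} (hf : HasSum f s) (hK : 0 ≤ K)
    (hbound : ∀ n, |f n| ≤ K / (n : ℝ) ^ 2) {M : ℕ} (hM : 0 < M) :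
    |s - ∑ n ∈ Finset.range M, f n| ≤ 2 * K / M := by
  have hlim := (hf.tendsto_sum_nat.sub_const (∑ n ∈ Finset.range M, f n)).abs
  refine le_of_tendsto hlim ?_
  filter_upwards [Filter.eventually_ge_atTop M] with m hm
  rw [← Finset.sum_Ico_eq_sub _ hm]
  obtain ⟨k, rfl⟩ : ∃ k, M = k + 1 := ⟨M - 1, by omega⟩
  have hIoo : Finset.Ico (k + 1) m = Finset.Ioo k m := by
    ext n
    simp only [Finset.mem_Ico, Finset.mem_Ioo]
    omega
  calc |∑ n ∈ Finset.Ico (k + 1) m, f n| ≤ ∑ n ∈ Finset.Ico (k + 1) m, |f n| :=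
        Finset.abs_sum_le_sum_abs _ _
    _ ≤ ∑ n ∈ Finset.Ioo k m, K * ((n : ℝ) ^ 2)⁻¹ := by
        rw [hIoo]
        exact Finset.sum_le_sum fun n _ => (hbound n).trans_eq (div_eq_mul_inv _ _)
    _ ≤ K * (2 / ((k : ℝ) + 1)) := by
        rw [← Finset.mul_sum]
        exact mul_le_mul_of_nonneg_left (sum_Ioo_inv_sq_le k m) hK
    _ = _ := by
        push_cast
        ring

lemma sum_range_two_pow {E : Type*} [AddCommMonoid E] (f : ℕ → E) (h0 : f 0 = 0) (R : ℕ) :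
    ∑ n ∈ Finset.range (2 ^ R), f n =
      ∑ k ∈ Finset.range R, ∑ n ∈ Finset.Ico (2 ^ k) (2 * 2 ^ k), f n := by
  induction R with
  | zero => simp [h0]
  | succ R ih =>
    rw [Finset.sum_range_succ, ← ih, Finset.range_eq_Ico, Finset.range_eq_Ico, pow_succ',
      Finset.sum_Ico_consecutive _ (Nat.zero_le _) (by omega)]

lemma abs_sum_cos_block_le {H N : ℕ} (hH : 0 < H) (hN : 3 ≤ N) (hHN : (H : ℝ) ≤ 4 * (N : ℝ) ^ 2)
    {A B : Finset ℕ} (hA : A ⊆ Finset.Icc (N + 1) (2 * N)) (hB : B ⊆ Finset.Icc (N + 1) (2 * N))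
    (c : ℕ → ℝ) (hc1 : ∀ n ∈ Finset.Ico H (2 * H), |c n| ≤ 1 / H)
    (hc2 : ∀ n ∈ Finset.Ico H (2 * H), |c n| ≤ √N / (H : ℝ) ^ 2) :
    |∑ b ∈ B, ∑ p ∈ Finset.Ico H (2 * H) ×ˢ A, c p.1 * Real.cos (sqrtFreq p * √b)| ≤
      630 * N * √B.card * √(Real.log N) := by
  have hN' : (3 : ℝ) ≤ N := by exact_mod_cast hN
  have hH' : (0 : ℝ) < H := by exact_mod_cast hH
  have hlog1 : 1 ≤ Real.log N := by
    rw [Real.le_log_iff_exp_le (by linarith)]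
    linarith [Real.exp_one_lt_d9]
  have hlog2 : Real.log 2 ≤ 0.7 := by linarith [Real.log_two_lt_d9]
  have hL : 1 + Real.log (8 * (H : ℝ) ^ 2 * N) ≤ 11 * Real.log N := by
    have h1 : 8 * (H : ℝ) ^ 2 * N ≤ 2 ^ 7 * (N : ℝ) ^ 5 := by
      calc 8 * (H : ℝ) ^ 2 * N ≤ 8 * (4 * (N : ℝ) ^ 2) ^ 2 * N := by gcongr
        _ = _ := by ring
    have h2 := Real.log_le_log (by positivity) h1
    rw [Real.log_mul (x := 2 ^ 7) (by positivity) (by positivity), Real.log_pow,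
      Real.log_pow] at h2
    push_cast at h2
    linarith
  set G : ℕ → ℝ := fun b => ∑ p ∈ Finset.Ico H (2 * H) ×ˢ A, c p.1 * Real.cos (sqrtFreq p * √b)
  have hG : ∑ b ∈ B, G b ^ 2 ≤ 35200 * (N : ℝ) ^ 2 * (11 * Real.log N) :=
    (Finset.sum_le_sum_of_subset_of_nonneg hB fun _ _ _ => sq_nonneg _).trans
      ((sum_sq_cos_block_le hH (by omega) hA c hc1 hc2).trans (by gcongr))
  have hCS : (∑ b ∈ B, G b) ^ 2 ≤ B.card * ∑ b ∈ B, G b ^ 2 := sq_sum_le_card_mul_sum_sq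
  apply abs_le_of_sq_le_sq _ (by positivity)
  rw [mul_pow, mul_pow, Real.sq_sqrt (by positivity), Real.sq_sqrt (by linarith), mul_pow]
  have h3 : (B.card : ℝ) * ∑ b ∈ B, G b ^ 2 ≤
      B.card * (35200 * (N : ℝ) ^ 2 * (11 * Real.log N)) := by gcongr
  have h4 : 0 ≤ (N : ℝ) ^ 2 * B.card * Real.log N := by positivity
  linarith

lemma abs_sum_trapezoid_sub_le {N : ℕ} (hN : 4 ≤ N) {A B : Finset ℕ}
    (hA : A ⊆ Finset.Icc (N + 1) (2 * N)) (hB : B ⊆ Finset.Icc (N + 1) (2 * N)) {u : ℝ}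
    (hu : 0 ≤ u) (huw : u + (√N)⁻¹ ≤ 1 / 2) :
    |∑ p ∈ A ×ˢ B, trapezoid u (√N)⁻¹ √(p.1 * p.2) - (2 * u + (√N)⁻¹) * (A.card * B.card)| ≤
      3150 * N * √B.card * (√(Real.log N) * Real.log N) + N := by
  have hN' : (4 : ℝ) ≤ N := by exact_mod_cast hN
  set w : ℝ := (√(N : ℝ))⁻¹ with hw_def
  have hw : 0 < w := inv_pos.2 (Real.sqrt_pos.2 (by linarith))
  have hlog1 : 1 ≤ Real.log N := by
    rw [Real.le_log_iff_exp_le (by linarith)]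
    linarith [Real.exp_one_lt_d9]
  set c := trapezoidCoeff u w with hc
  have hc1 : ∀ n : ℕ, |c n| ≤ 1 / n := abs_trapezoidCoeff_le_div u hw
  have hc2 : ∀ n : ℕ, |c n| ≤ √N / (n : ℝ) ^ 2 := fun n =>
    (abs_trapezoidCoeff_le_div_sq u hw n).trans_eq (by
      rw [hw_def, one_div, mul_inv, inv_inv, div_eq_mul_inv])
  set l := Nat.log 2 N with hl
  set R := 2 * (l + 1) with hR
  have hpowR : (2 : ℝ) ^ R = ((2 : ℝ) ^ (l + 1)) ^ 2 := by rw [hR, mul_comm 2, pow_mul]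
  have hlow : (N : ℝ) ^ 2 ≤ 2 ^ R := by
    have h : N < 2 ^ (l + 1) := Nat.lt_pow_succ_log_self (by norm_num) N
    rw [hpowR]
    exact pow_le_pow_left₀ (by positivity) (by exact_mod_cast h.le) 2
  have hlN : (2 : ℝ) ^ l ≤ N := by exact_mod_cast Nat.pow_log_le_self 2 (by omega : N ≠ 0)
  have hupp : (2 : ℝ) ^ R ≤ 4 * (N : ℝ) ^ 2 := by
    rw [hpowR, pow_succ 2 l, mul_pow]
    nlinarith [pow_le_pow_left₀ (by positivity : (0 : ℝ) ≤ 2 ^ l) hlN 2]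
  have hRlog : (R : ℝ) ≤ 5 * Real.log N := by
    have h := Real.log_le_log (by positivity) hlN
    rw [Real.log_pow] at h
    have h2 := Real.log_two_gt_d9
    have h3 : (0 : ℝ) ≤ l := by positivity
    rw [hR]
    push_cast
    nlinarith
  have hcos : ∀ (n : ℕ) (p : ℕ × ℕ), Real.cos (2 * Real.pi * n * √(p.1 * p.2)) =
      Real.cos (sqrtFreq (n, p.1) * √p.2) := by
    intro n p
    unfold sqrtFreq
    rw [Real.sqrt_mul (by positivity)]
    congr 1
    ring
  have htail : ∀ p ∈ A ×ˢ B, |trapezoid u w √(p.1 * p.2) - (2 * u + w) -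
      ∑ n ∈ Finset.range (2 ^ R), c n * Real.cos (2 * Real.pi * n * √(p.1 * p.2))| ≤
      2 * √N / (N : ℝ) ^ 2 := by
    intro p _
    refine (abs_sub_sum_range_le_of_hasSum (hasSum_trapezoid hu hw huw √(p.1 * p.2))
      (Real.sqrt_nonneg N) ?_ (by positivity : 0 < 2 ^ R)).trans ?_
    · intro n
      rw [abs_mul]
      exact (mul_le_of_le_one_right (abs_nonneg _) (Real.abs_cos_le_one _)).trans (hc2 n)
    · push_cast
      gcongr
  have hcard : ∀ S : Finset ℕ, S ⊆ Finset.Icc (N + 1) (2 * N) → (S.card : ℝ) ≤ N := by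
    intro S hS
    have h := Finset.card_le_card hS
    rw [Nat.card_Icc] at h
    exact_mod_cast (by omega : S.card ≤ N)
  have hsum : ∑ p ∈ A ×ˢ B, ∑ n ∈ Finset.range (2 ^ R),
      c n * Real.cos (2 * Real.pi * n * √(p.1 * p.2)) =
      ∑ k ∈ Finset.range R, ∑ b ∈ B, ∑ p ∈ Finset.Ico (2 ^ k) (2 * 2 ^ k) ×ˢ A,
        c p.1 * Real.cos (sqrtFreq p * √b) := by
    simp_rw [hcos]
    rw [Finset.sum_comm, sum_range_two_pow _ (by simp [hc, trapezoidCoeff])]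
    refine Finset.sum_congr rfl fun k _ => ?_
    rw [Finset.sum_comm, Finset.sum_product_right]
    refine Finset.sum_congr rfl fun b _ => ?_
    rw [Finset.sum_product_right]
  have hmain : |∑ p ∈ A ×ˢ B, ∑ n ∈ Finset.range (2 ^ R),
      c n * Real.cos (2 * Real.pi * n * √(p.1 * p.2))| ≤
      3150 * N * √B.card * (√(Real.log N) * Real.log N) := by
    rw [hsum]
    calc _ ≤ ∑ k ∈ Finset.range R, 630 * N * √B.card * √(Real.log N) := by
          refine (Finset.abs_sum_le_sum_abs _ _).trans (Finset.sum_le_sum fun k hk => ?_)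
          have hle : (2 : ℝ) ^ k ≤ 2 ^ R :=
            pow_le_pow_right₀ (by norm_num) (Finset.mem_range.1 hk).le
          have hpos : (0 : ℝ) < ((2 ^ k : ℕ) : ℝ) := by positivity
          apply abs_sum_cos_block_le (by positivity) (by omega) _ hA hB
          · intro n hn
            have : ((2 ^ k : ℕ) : ℝ) ≤ n := Nat.cast_le.2 (Finset.mem_Ico.1 hn).1
            exact (hc1 n).trans (by gcongr)
          · intro n hn
            have : ((2 ^ k : ℕ) : ℝ) ≤ n := Nat.cast_le.2 (Finset.mem_Ico.1 hn).1
            exact (hc2 n).trans (by gcongr)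
          · push_cast
            exact hle.trans hupp
      _ = R * (630 * N * √B.card * √(Real.log N)) := by
          rw [Finset.sum_const, Finset.card_range, nsmul_eq_mul]
      _ ≤ (5 * Real.log N) * (630 * N * √B.card * √(Real.log N)) := by gcongr
      _ = _ := by ring
  have herr : |∑ p ∈ A ×ˢ B, (trapezoid u w √(p.1 * p.2) - (2 * u + w) -
      ∑ n ∈ Finset.range (2 ^ R), c n * Real.cos (2 * Real.pi * n * √(p.1 * p.2)))| ≤ N := by
    have hsqrt : 2 * √(N : ℝ) ≤ N := by
      have h := Real.sq_sqrt (by linarith : (0 : ℝ) ≤ N)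
      have h2 : 2 ≤ √(N : ℝ) := by
        rw [Real.le_sqrt' (by norm_num)]
        linarith
      nlinarith
    calc _ ≤ ∑ p ∈ A ×ˢ B, 2 * √(N : ℝ) / (N : ℝ) ^ 2 :=
          (Finset.abs_sum_le_sum_abs _ _).trans (Finset.sum_le_sum htail)
      _ = A.card * B.card * (2 * √(N : ℝ) / (N : ℝ) ^ 2) := by
          rw [Finset.sum_const, Finset.card_product, nsmul_eq_mul]
          push_cast
          ring
      _ ≤ N * N * (2 * √(N : ℝ) / (N : ℝ) ^ 2) := by
          gcongr
          · exact_mod_cast hcard A hA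
          · exact_mod_cast hcard B hB
      _ = 2 * √(N : ℝ) := by field_simp
      _ ≤ N := hsqrt
  have hsplit : ∑ p ∈ A ×ˢ B, trapezoid u w √(p.1 * p.2) - (2 * u + w) * (A.card * B.card) =
      ∑ p ∈ A ×ˢ B, ∑ n ∈ Finset.range (2 ^ R),
        c n * Real.cos (2 * Real.pi * n * √(p.1 * p.2)) +
      ∑ p ∈ A ×ˢ B, (trapezoid u w √(p.1 * p.2) - (2 * u + w) -
        ∑ n ∈ Finset.range (2 ^ R), c n * Real.cos (2 * Real.pi * n * √(p.1 * p.2))) := by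
    rw [Finset.sum_sub_distrib, Finset.sum_sub_distrib, Finset.sum_const, Finset.card_product,
      nsmul_eq_mul]
    push_cast
    ring
  rw [hsplit]
  exact (abs_add_le _ _).trans (add_le_add hmain herr)

lemma Hcount_eq_sum (A B : Finset ℕ) (Δ : ℝ) :
    (Hcount A B Δ : ℝ) =
      ∑ p ∈ A ×ˢ B, if distNearestInt √(p.1 * p.2) < Δ then (1 : ℝ) else 0 := by
  unfold Hcount
  rw [Finset.card_filter]
  push_cast
  rfl

lemma Hcount_comm (A B : Finset ℕ) (Δ : ℝ) : Hcount A B Δ = Hcount B A Δ := by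
  rw [← Nat.cast_inj (R := ℝ), Hcount_eq_sum, Hcount_eq_sum, Finset.sum_product,
    Finset.sum_product_right]
  simp_rw [mul_comm]

lemma abs_Hcount_sub_le_sqrt {N : ℕ} (hN : 4 ≤ N) {A B : Finset ℕ}
    (hA : A ⊆ Finset.Icc (N + 1) (2 * N)) (hB : B ⊆ Finset.Icc (N + 1) (2 * N)) {Δ : ℝ}
    (hΔ : 0 < Δ) (hΔ' : Δ ≤ 1 / 2) :
    |(Hcount A B Δ : ℝ) - 2 * Δ * (A.card * B.card)| ≤
      2 * (√N)⁻¹ * (A.card * B.card) +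
        (3150 * N * √B.card * (√(Real.log N) * Real.log N) + N) := by
  have hN' : (4 : ℝ) ≤ N := by exact_mod_cast hN
  set w : ℝ := (√(N : ℝ))⁻¹ with hw_def
  have hw : 0 < w := inv_pos.2 (Real.sqrt_pos.2 (by linarith))
  set E : ℝ := 3150 * N * √B.card * (√(Real.log N) * Real.log N) + N with hE
  have hE0 : 0 ≤ E := by
    have := Real.log_natCast_nonneg N
    positivity
  set P : ℝ := A.card * B.card with hP
  have hP0 : 0 ≤ P := by positivity
  have hwP : 0 ≤ w * P := by positivity
  have hHP : (Hcount A B Δ : ℝ) ≤ P := by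
    have h : Hcount A B Δ ≤ (A ×ˢ B).card := Finset.card_filter_le _ _
    rw [Finset.card_product] at h
    rw [hP]
    exact_mod_cast h
  rw [abs_le]
  constructor
  · by_cases hwΔ : w ≤ Δ
    · have h := abs_sum_trapezoid_sub_le hN hA hB (u := Δ - w) (by linarith) (by linarith)
      have hle : ∑ p ∈ A ×ˢ B, trapezoid (Δ - w) w √(p.1 * p.2) ≤ Hcount A B Δ := by
        rw [Hcount_eq_sum]
        refine Finset.sum_le_sum fun p _ => ?_
        split_ifs with hp
        · exact trapezoid_le_one (by linarith) hw _
        · exact (trapezoid_eq_zero (by linarith) hw (by linarith)).le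
      have h' := (abs_le.1 h).1
      linarith
    · have h1 : Δ * P ≤ w * P := by
        gcongr
        exact (not_le.1 hwΔ).le
      have h2 : (0 : ℝ) ≤ Hcount A B Δ := by positivity
      linarith
  · by_cases hwΔ : Δ + w ≤ 1 / 2
    · have h := abs_sum_trapezoid_sub_le hN hA hB hΔ.le hwΔ
      have hle : (Hcount A B Δ : ℝ) ≤ ∑ p ∈ A ×ˢ B, trapezoid Δ w √(p.1 * p.2) := by
        rw [Hcount_eq_sum]
        refine Finset.sum_le_sum fun p _ => ?_
        split_ifs with hp
        · exact (trapezoid_eq_one hw hp.le).ge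
        · exact trapezoid_nonneg hΔ.le hw _
      have h' := (abs_le.1 h).2
      linarith
    · have h1 : (1 / 2) * P ≤ (Δ + w) * P := by
        gcongr
        exact (not_le.1 hwΔ).le
      linarith

lemma abs_Hcount_sub_le_of_card_le {N : ℕ} (hN : 4 ≤ N) {A B : Finset ℕ}
    (hA : A ⊆ Finset.Icc (N + 1) (2 * N)) (hB : B ⊆ Finset.Icc (N + 1) (2 * N))
    (hpos : 1 ≤ (A.card : ℝ) * B.card) (hBA : B.card ≤ A.card) {Δ : ℝ}
    (hΔ : 0 < Δ) (hΔ' : Δ ≤ 1 / 2) :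
    |(Hcount A B Δ : ℝ) - 2 * Δ * (A.card * B.card)| ≤
      3153 * N * ((A.card : ℝ) * B.card) ^ ((1 : ℝ) / 4) * (Real.log N) ^ ((3 : ℝ) / 2) := by
  have hN' : (4 : ℝ) ≤ N := by exact_mod_cast hN
  have hlog1 : 1 ≤ Real.log N := by
    rw [Real.le_log_iff_exp_le (by linarith)]
    linarith [Real.exp_one_lt_d9]
  refine (abs_Hcount_sub_le_sqrt hN hA hB hΔ hΔ').trans ?_
  have hcardA : (A.card : ℝ) ≤ N := by
    have h := Finset.card_le_card hA
    rw [Nat.card_Icc] at h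
    exact_mod_cast (by omega : A.card ≤ N)
  have hBA' : (B.card : ℝ) ≤ A.card := by exact_mod_cast hBA
  have hB0 : (0 : ℝ) ≤ B.card := by positivity
  set P : ℝ := A.card * B.card with hP
  have hlogpow : (Real.log N) ^ ((3 : ℝ) / 2) = √(Real.log N) * Real.log N := by
    rw [Real.sqrt_eq_rpow, ← Real.rpow_add_one (by linarith)]
    norm_num
  have hlogpow1 : 1 ≤ (Real.log N) ^ ((3 : ℝ) / 2) := Real.one_le_rpow hlog1 (by norm_num)
  have hq1 : 1 ≤ P ^ ((1 : ℝ) / 4) := Real.one_le_rpow hpos (by norm_num)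
  set q := P ^ ((1 : ℝ) / 4) with hq
  have hq4 : q ^ 4 = P := by
    rw [hq, ← Real.rpow_natCast, ← Real.rpow_mul (by linarith)]
    norm_num
  have hBq : √(B.card : ℝ) ≤ q := by
    rw [Real.sqrt_le_left (by linarith)]
    apply le_of_sq_le_sq _ (by positivity)
    calc (B.card : ℝ) ^ 2 = B.card * B.card := sq _
      _ ≤ A.card * B.card := by gcongr
      _ = (q ^ 2) ^ 2 := by rw [← hP, ← hq4]; ring
  have hr0 : 0 < √(N : ℝ) := Real.sqrt_pos.2 (by linarith)
  have hqr : q ≤ √(N : ℝ) := by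
    apply le_of_sq_le_sq _ hr0.le
    rw [Real.sq_sqrt (by linarith)]
    apply le_of_sq_le_sq _ (by linarith)
    calc (q ^ 2) ^ 2 = P := by rw [← hq4]; ring
      _ ≤ N * N := by
        rw [hP]
        gcongr
        exact_mod_cast hBA'.trans hcardA
      _ = (N : ℝ) ^ 2 := (sq _).symm
  have hwP : (√(N : ℝ))⁻¹ * P ≤ N * q := by
    rw [inv_mul_le_iff₀ hr0, ← hq4]
    have h1 : q ^ 3 ≤ √(N : ℝ) ^ 3 := pow_le_pow_left₀ (by linarith) hqr 3
    have h2 : √(N : ℝ) ^ 2 = N := Real.sq_sqrt (by linarith)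
    calc q ^ 4 = q ^ 3 * q := by ring
      _ ≤ √(N : ℝ) ^ 3 * q := by gcongr
      _ = √(N : ℝ) * (√(N : ℝ) ^ 2 * q) := by ring
      _ = _ := by rw [h2]
  rw [← hlogpow]
  set g := (Real.log N) ^ ((3 : ℝ) / 2)
  have h1 : (N : ℝ) * q ≤ N * q * g := le_mul_of_one_le_right (by positivity) hlogpow1
  have h2 : (N : ℝ) ≤ N * q := le_mul_of_one_le_right (by positivity) hq1
  have h3 : 3150 * N * √(B.card : ℝ) * g ≤ 3150 * N * q * g := by gcongr
  linarith

end Discrepancy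

/-- **Theorem 1.1.** For every `ε > 0` there is a constant `C > 0` such that for all
sufficiently large `N`, all `𝔄, 𝔅 ⊆ {N+1, …, 2N}` with `|𝔄||𝔅| ≥ N^{4/3+ε}` and all
`0 < Δ ≤ 1/2` one has
`|H(𝔄,𝔅;Δ) − 2Δ|𝔄||𝔅|| ≤ C N (|𝔄||𝔅|)^{1/4} (log N)^{3/2}`. -/
theorem H_asymptotic :
    ∀ ε : ℝ, 0 < ε → ∃ C : ℝ, 0 < C ∧ ∃ N₀ : ℕ, ∀ N : ℕ, N₀ ≤ N →
      ∀ A B : Finset ℕ, A ⊆ Finset.Icc (N + 1) (2 * N) → B ⊆ Finset.Icc (N + 1) (2 * N) →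
        (N : ℝ) ^ ((4 : ℝ) / 3 + ε) ≤ (A.card : ℝ) * B.card →
        ∀ Δ : ℝ, 0 < Δ → Δ ≤ 1 / 2 →
          |(Hcount A B Δ : ℝ) - 2 * Δ * A.card * B.card| ≤
            C * N * ((A.card : ℝ) * B.card) ^ ((1 : ℝ) / 4) * (Real.log N) ^ ((3 : ℝ) / 2) := by
  intro ε hε
  refine ⟨3153, by norm_num, 4, fun N hN A B hA hB hcard Δ hΔ hΔ' => ?_⟩
  have hpos : 1 ≤ (A.card : ℝ) * B.card :=
    (Real.one_le_rpow (by exact_mod_cast (by omega : 1 ≤ N)) (by linarith)).trans hcard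
  rw [mul_assoc (2 * Δ)]
  rcases le_total B.card A.card with h | h
  · exact abs_Hcount_sub_le_of_card_le hN hA hB hpos h hΔ hΔ'
  · rw [mul_comm (A.card : ℝ)] at hpos ⊢
    rw [Hcount_comm]
    exact abs_Hcount_sub_le_of_card_le hN hB hA hpos h hΔ hΔ'
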